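/- Let E be a real inner product space and let Π be a finite set of vectors in E such that ⟨γ, γ'⟩ ≤ 0 for every pair of distinct elements γ, γ' of Π. Let ω₁, ω₂ ∈ E be dominant with respect to Π, i.e. ⟨ω₁, γ⟩ ≥ 0 and ⟨ω₂, γ⟩ ≥ 0 for all γ ∈ Π. Suppose there exist disjoint subsets I₁, I₂ ⊆ Π and nonnegative real coefficients (n_γ)_{γ∈I₁} and (m_γ)_{γ∈I₂} such that ω₁ − Σ_{γ∈I₁} n_γ·γ = ω₂ − Σ_{γ∈I₂} m_γ·γ. Then the common value ω := ω₁ − Σ_{γ∈I₁} n_γ·γ is also dominant with respect to Π, i.e. ⟨ω, γ⟩ ≥ 0 for all γ ∈ Π. -/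

import Mathlib

open scoped RealInnerProductSpace

/-- Subtracting a non-negative combination of vectors of `I` from `ω` does not decrease the inner
product with a vector that has non-positive inner product with every element of `I`. -/
lemma inner_sub_sum_smul_nonneg
    {E : Type*} [NormedAddCommGroup E] [InnerProductSpace ℝ E]
    {I : Finset E} {c : E → ℝ} {ω γ : E}
    (hω : 0 ≤ ⟪ω, γ⟫) (hc : ∀ γ' ∈ I, 0 ≤ c γ') (hI : ∀ γ' ∈ I, ⟪γ', γ⟫ ≤ 0) :
    0 ≤ ⟪ω - ∑ γ' ∈ I, c γ' • γ', γ⟫ := by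
  rw [inner_sub_left, sum_inner, sub_nonneg]
  refine (Finset.sum_nonpos fun γ' hγ' => ?_).trans hω
  rw [real_inner_smul_left]
  exact mul_nonpos_of_nonneg_of_nonpos (hc γ' hγ') (hI γ' hγ')

/-- If two dominant vectors `ω₁, ω₂` (with respect to a finite set `Φ` of vectors with
pairwise non-positive inner products) differ by non-negative combinations over disjoint
subsets `I₁, I₂ ⊆ Φ`, then their common value `ω = ω₁ - ∑_{γ ∈ I₁} n γ • γ` is dominant. -/
theorem dominant_of_common_value
    {E : Type*} [NormedAddCommGroup E] [InnerProductSpace ℝ E]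
    (Φ : Finset E)
    (hneg : ∀ γ ∈ Φ, ∀ γ' ∈ Φ, γ ≠ γ' → ⟪γ, γ'⟫ ≤ 0)
    (ω₁ ω₂ : E)
    (hω₁ : ∀ γ ∈ Φ, 0 ≤ ⟪ω₁, γ⟫)
    (hω₂ : ∀ γ ∈ Φ, 0 ≤ ⟪ω₂, γ⟫)
    (I₁ I₂ : Finset E) (hI₁ : I₁ ⊆ Φ) (hI₂ : I₂ ⊆ Φ) (hdisj : Disjoint I₁ I₂)
    (n m : E → ℝ)
    (hn : ∀ γ ∈ I₁, 0 ≤ n γ) (hm : ∀ γ ∈ I₂, 0 ≤ m γ)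
    (heq : ω₁ - ∑ γ ∈ I₁, n γ • γ = ω₂ - ∑ γ ∈ I₂, m γ • γ) :
    ∀ γ ∈ Φ, 0 ≤ ⟪ω₁ - ∑ γ' ∈ I₁, n γ' • γ', γ⟫ := by
  intro γ hγ
  by_cases h : γ ∈ I₁
  · rw [heq]
    exact inner_sub_sum_smul_nonneg (hω₂ γ hγ) hm fun γ' hγ' =>
      hneg γ' (hI₂ hγ') γ hγ fun e => Finset.disjoint_left.mp hdisj h (e ▸ hγ')
  · exact inner_sub_sum_smul_nonneg (hω₁ γ hγ) hn fun γ' hγ' =>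
      hneg γ' (hI₁ hγ') γ hγ fun e => h (e ▸ hγ')
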